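/- There exists an absolute constant C > 0 such that the following holds. Let (d_1,…,d_n) be positive integers with even sum such that d_max^4 ≤ (d−2)n. Fix a partition A_1,…,A_n of {1,…,(d−1)n} with |A_j| = d_j − 1 for each j, let B be a uniformly random (n−2)-element subset of {1,…,(d−1)n}, and define the random vector X = (X_1,…,X_n) by X_j = |A_j ∩ B| + 1. Then E( e^{g(X)} ) = exp( E g(X) + E ), where |E| ≤ C · d_max^4 / ((d−2)n). -/

import Mathlib

attribute [local instance] Classical.propDecidable

namespace ExpectedSpanningTrees

/-- Average degree `d` of the degree sequence. -/
noncomputable def davg (n : ℕ) (d : Fin n → ℕ) : ℝ := (∑ j, (d j : ℝ)) / n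

/-- The variance-type quantity `R = (1/n) Σ (d_j − d)²`. -/
noncomputable def Rvar (n : ℕ) (d : Fin n → ℕ) : ℝ :=
  (∑ j, ((d j : ℝ) - davg n d) ^ 2) / n

/-- `λ(x) = (1/(2(d−2)n+4)) Σ_j (d_j−x_j)_2`. -/
noncomputable def lamx (n : ℕ) (d x : Fin n → ℕ) : ℝ :=
  (∑ j, (Nat.descFactorial (d j - x j) 2 : ℝ)) / (2 * ((davg n d - 2) * n) + 4)

/-- `μ(T) = (1/((d−2)n+2)) Σ_{{i,j}∈E(T)} (d_i−x_i)(d_j−x_j)`. -/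
noncomputable def muT (n : ℕ) (d x : Fin n → ℕ) (T : SimpleGraph (Fin n)) : ℝ :=
  (∑ e ∈ T.edgeFinset,
    Sym2.lift ⟨fun i j => ((d i - x i : ℕ) : ℝ) * ((d j - x j : ℕ) : ℝ),
      fun i j => by ring⟩ e) / ((davg n d - 2) * n + 2)

/-- The set of labelled trees on `{1,…,n}` with degree sequence `x`. -/
noncomputable def treesWith (n : ℕ) (x : Fin n → ℕ) : Finset (SimpleGraph (Fin n)) :=
  Finset.univ.filter (fun T => T.IsTree ∧ ∀ j, T.degree j = x j)

/-- `μ̄(x)`, the average of `μ(T)` over trees `T` with degree sequence `x`. -/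
noncomputable def mubar (n : ℕ) (d x : Fin n → ℕ) : ℝ :=
  (∑ T ∈ treesWith n x, muT n d x T) / ((treesWith n x).card : ℝ)

/-- `g(x) = (R+d²)²/(4d²) − 1/4 − λ(x) − λ(x)² − μ̄(x)`. -/
noncomputable def gfun (n : ℕ) (d x : Fin n → ℕ) : ℝ :=
  (Rvar n d + davg n d ^ 2) ^ 2 / (4 * davg n d ^ 2) - 1 / 4
    - lamx n d x - lamx n d x ^ 2 - mubar n d x

/-- Jensen's inequality for the exponential function and a finite average. -/
theorem card_mul_exp_mean_le {α : Type*} (S : Finset α) (h : α → ℝ) :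
    S.card * Real.exp ((∑ x ∈ S, h x) / S.card) ≤ ∑ x ∈ S, Real.exp (h x) := by
  rcases S.eq_empty_or_nonempty with rfl | hS
  · simp
  have hN : (0 : ℝ) < S.card := by exact_mod_cast hS.card_pos
  set m := (∑ x ∈ S, h x) / S.card with hm
  have h1 : ∑ y ∈ S, Real.exp m * (1 + (h y - m)) ≤ ∑ y ∈ S, Real.exp (h y) := by
    refine Finset.sum_le_sum fun y _ => ?_
    have h2 : Real.exp (h y) = Real.exp m * Real.exp (h y - m) := by
      rw [← Real.exp_add]; ring_nf
    rw [h2]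
    have := Real.add_one_le_exp (h y - m)
    gcongr
    linarith
  refine le_trans (le_of_eq ?_) h1
  rw [← Finset.mul_sum, Finset.sum_add_distrib, Finset.sum_sub_distrib]
  simp only [Finset.sum_const, nsmul_eq_mul]
  have : (S.card : ℝ) * m = ∑ x ∈ S, h x := by rw [hm]; field_simp
  rw [this]; ring

/-- Exponential moment bound for a function of bounded oscillation on a finite set. -/
theorem sum_exp_le_of_oscillation_le {α : Type*} (S : Finset α) (h : α → ℝ) (c : ℝ)
    (hc : ∀ x ∈ S, ∀ y ∈ S, |h x - h y| ≤ c) :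
    ∑ x ∈ S, Real.exp (h x) ≤ S.card * Real.exp ((∑ x ∈ S, h x) / S.card + c ^ 2 / 2) := by
  rcases S.eq_empty_or_nonempty with rfl | hS
  · simp
  have hN : (0 : ℝ) < S.card := by exact_mod_cast hS.card_pos
  set m := (∑ x ∈ S, h x) / S.card with hm
  have hlow : (S.card : ℝ) * Real.exp (-m) ≤ ∑ y ∈ S, Real.exp (-h y) := by
    have := card_mul_exp_mean_le S (fun y => -h y)
    rwa [Finset.sum_neg_distrib, neg_div] at this
  have hprod : (∑ x ∈ S, Real.exp (h x)) * ∑ y ∈ S, Real.exp (-h y)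
      ≤ (S.card : ℝ) ^ 2 * Real.exp (c ^ 2 / 2) := by
    have hexp : (∑ x ∈ S, Real.exp (h x)) * ∑ y ∈ S, Real.exp (-h y)
        = ∑ x ∈ S, ∑ y ∈ S, Real.exp (h x - h y) := by
      rw [Finset.sum_mul_sum]
      refine Finset.sum_congr rfl fun x _ => Finset.sum_congr rfl fun y _ => ?_
      rw [← Real.exp_add]; ring_nf
    have hsymm : ∑ x ∈ S, ∑ y ∈ S, Real.exp (h x - h y)
        = ∑ x ∈ S, ∑ y ∈ S, Real.cosh (h x - h y) := by
      have h2 : ∑ x ∈ S, ∑ y ∈ S, Real.exp (h x - h y)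
          = ∑ x ∈ S, ∑ y ∈ S, Real.exp (-(h x - h y)) := by
        rw [Finset.sum_comm]
        refine Finset.sum_congr rfl fun x _ => Finset.sum_congr rfl fun y _ => ?_
        ring_nf
      have h3 : ∑ x ∈ S, ∑ y ∈ S, Real.cosh (h x - h y)
          = (∑ x ∈ S, ∑ y ∈ S, Real.exp (h x - h y)
            + ∑ x ∈ S, ∑ y ∈ S, Real.exp (-(h x - h y))) / 2 := by
        simp only [Real.cosh_eq, ← Finset.sum_add_distrib, Finset.sum_div]
      rw [h3, ← h2]; ring
    rw [hexp, hsymm]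
    calc ∑ x ∈ S, ∑ y ∈ S, Real.cosh (h x - h y)
        ≤ ∑ x ∈ S, ∑ y ∈ S, Real.exp (c ^ 2 / 2) := by
          refine Finset.sum_le_sum fun x hx => Finset.sum_le_sum fun y hy => ?_
          refine (Real.cosh_le_exp_half_sq _).trans (Real.exp_le_exp.2 ?_)
          have := hc x hx y hy
          have h4 : (h x - h y) ^ 2 ≤ c ^ 2 := by
            rw [← sq_abs]; exact pow_le_pow_left₀ (abs_nonneg _) this 2
          linarith
      _ = _ := by simp; ring
  have hpos : 0 ≤ ∑ x ∈ S, Real.exp (h x) := Finset.sum_nonneg fun _ _ => (Real.exp_pos _).le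
  have h5 : (∑ x ∈ S, Real.exp (h x)) * ((S.card : ℝ) * Real.exp (-m))
      ≤ (S.card : ℝ) ^ 2 * Real.exp (c ^ 2 / 2) :=
    (mul_le_mul_of_nonneg_left hlow hpos).trans hprod
  have h6 : Real.exp (-m) * Real.exp m = 1 := by rw [← Real.exp_add]; simp
  rw [Real.exp_add]
  have h7 := mul_le_mul_of_nonneg_right h5 (Real.exp_pos m).le
  have h8 : (S.card : ℝ) * ∑ x ∈ S, Real.exp (h x)
      ≤ (S.card : ℝ) * (S.card * (Real.exp m * Real.exp (c ^ 2 / 2))) := by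
    calc _ = (∑ x ∈ S, Real.exp (h x)) * ((S.card : ℝ) * Real.exp (-m)) * Real.exp m := by
          linear_combination (-(S.card : ℝ) * ∑ x ∈ S, Real.exp (h x)) * h6
      _ ≤ _ := h7
      _ = _ := by ring
  exact le_of_mul_le_mul_left h8 hN

/-- Double counting of pairs consisting of a `(k+1)`-subset and one of its elements. -/
theorem sum_sum_powersetCard_erase {α : Type*} [DecidableEq α] (S : Finset α) (k : ℕ)
    (F : Finset α → ℝ) :
    ∑ x ∈ S, ∑ B ∈ (S.erase x).powersetCard k, F (insert x B)
      = (k + 1) * ∑ B ∈ S.powersetCard (k + 1), F B := by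
  have h1 : (k + 1 : ℝ) * ∑ B ∈ S.powersetCard (k + 1), F B
      = ∑ B ∈ S.powersetCard (k + 1), ∑ x ∈ B, F B := by
    rw [Finset.mul_sum]
    refine Finset.sum_congr rfl fun B hB => ?_
    rw [Finset.sum_const, (Finset.mem_powersetCard.1 hB).2]; simp
  rw [h1, Finset.sum_sigma', Finset.sum_sigma']
  refine Finset.sum_bij' (fun p _ => ⟨insert p.1 p.2, p.1⟩) (fun p _ => ⟨p.2, p.1.erase p.2⟩)
    ?_ ?_ ?_ ?_ ?_
  · rintro ⟨x, B⟩ h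
    simp only [Finset.mem_sigma, Finset.mem_powersetCard] at h ⊢
    obtain ⟨hx, hB, hc⟩ := h
    have hxB : x ∉ B := fun hh => by simpa using hB hh
    refine ⟨⟨?_, by rw [Finset.card_insert_of_notMem hxB, hc]⟩, by simp⟩
    exact Finset.insert_subset hx (hB.trans (Finset.erase_subset _ _))
  · rintro ⟨B, x⟩ h
    simp only [Finset.mem_sigma, Finset.mem_powersetCard] at h ⊢
    obtain ⟨⟨hB, hc⟩, hx⟩ := h
    exact ⟨hB hx, Finset.erase_subset_erase _ hB, by rw [Finset.card_erase_of_mem hx, hc]; rfl⟩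
  · rintro ⟨x, B⟩ h
    simp only [Finset.mem_sigma, Finset.mem_powersetCard] at h
    have hxB : x ∉ B := fun hh => by simpa using h.2.1 hh
    simp [Finset.erase_insert hxB]
  · rintro ⟨B, x⟩ h
    simp only [Finset.mem_sigma, Finset.mem_powersetCard] at h
    simp [Finset.insert_erase h.2]
  · rintro ⟨x, B⟩ h
    rfl

/-- `f` changes by at most `c` when one element of a `k`-subset of `S` is exchanged. -/
def SwapLipschitz {α : Type*} [DecidableEq α] (S : Finset α) (k : ℕ) (f : Finset α → ℝ) (c : ℝ) : Prop :=
  ∀ D : Finset α, ∀ a b : α, a ∉ D → b ∉ D → a ≠ b →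
    insert a D ∈ S.powersetCard k → insert b D ∈ S.powersetCard k →
      |f (insert a D) - f (insert b D)| ≤ c

/-- Averaging over the remaining elements preserves the oscillation bound. -/
theorem SwapLipschitz.abs_sum_sub_sum_le {α : Type*} [DecidableEq α] {S : Finset α} {k : ℕ} {f : Finset α → ℝ}
    {c : ℝ} (hc0 : 0 ≤ c) (hf : SwapLipschitz S (k + 1) f c) {x y : α} (hx : x ∈ S) (hy : y ∈ S) :
    |∑ B ∈ (S.erase x).powersetCard k, f (insert x B)
      - ∑ B ∈ (S.erase y).powersetCard k, f (insert y B)|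
      ≤ ((S.erase x).powersetCard k).card * c := by
  rcases eq_or_ne x y with rfl | hxy
  · simp; positivity
  set σ := Equiv.swap x y with hσ
  have hre : ∑ B ∈ (S.erase y).powersetCard k, f (insert y B)
      = ∑ B ∈ (S.erase x).powersetCard k, f (insert y (B.map σ.toEmbedding)) := by
    have hmap : (S.erase x).map σ.toEmbedding = S.erase y := by
      ext z
      simp only [Finset.mem_map_equiv, Finset.mem_erase, hσ, Equiv.symm_swap]
      rcases eq_or_ne z x with rfl | hzx
      · simp [Equiv.swap_apply_left, hxy, hx, hy, hxy.symm]
      rcases eq_or_ne z y with rfl | hzy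
      · simp [Equiv.swap_apply_right]
      · simp [Equiv.swap_apply_of_ne_of_ne hzx hzy, hzx, hzy]
    rw [← hmap, Finset.powersetCard_map, Finset.sum_map]
    rfl
  rw [hre, ← Finset.sum_sub_distrib]
  refine (Finset.abs_sum_le_sum_abs _ _).trans ?_
  refine (Finset.sum_le_card_nsmul _ _ c fun B hB => ?_).trans (by simp)
  rw [Finset.mem_powersetCard] at hB
  have hxB : x ∉ B := fun hh => by simpa using hB.1 hh
  have hBS : B ⊆ S := hB.1.trans (Finset.erase_subset _ _)
  by_cases hyB : y ∈ B
  · have : insert y (B.map σ.toEmbedding) = insert x B := by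
      ext z
      simp only [Finset.mem_insert, Finset.mem_map_equiv, hσ, Equiv.symm_swap]
      rcases eq_or_ne z x with rfl | hzx
      · simp [Equiv.swap_apply_left, hyB]
      rcases eq_or_ne z y with rfl | hzy
      · simp [hyB]
      · simp [Equiv.swap_apply_of_ne_of_ne hzx hzy, hzx, hzy]
    rw [this]; simpa using hc0
  · have : B.map σ.toEmbedding = B := by
      ext z
      simp only [Finset.mem_map_equiv, hσ, Equiv.symm_swap]
      rcases eq_or_ne z x with rfl | hzx
      · simp [Equiv.swap_apply_left, hyB, hxB]
      rcases eq_or_ne z y with rfl | hzy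
      · simp [hyB, hxB]
      · simp [Equiv.swap_apply_of_ne_of_ne hzx hzy]
    rw [this]
    refine hf B x y hxB hyB hxy ?_ ?_ <;>
      simp [Finset.mem_powersetCard, Finset.insert_subset_iff, *]

theorem SwapLipschitz.erase {α : Type*} [DecidableEq α] {S : Finset α} {k : ℕ} {f : Finset α → ℝ}
    {c : ℝ} (hf : SwapLipschitz S (k + 1) f c) {x : α} (hx : x ∈ S) :
    SwapLipschitz (S.erase x) k (fun B => f (insert x B)) c := by
  intro D a b ha hb hab hA hB
  simp only [Finset.mem_powersetCard, Finset.insert_subset_iff, Finset.mem_erase,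
    Finset.card_insert_of_notMem ha, Finset.card_insert_of_notMem hb] at hA hB
  have hxD : x ∉ D := fun h => by simpa using hA.1.2 h
  have hDS : D ⊆ S := hA.1.2.trans (Finset.erase_subset _ _)
  have hax := hA.1.1.1
  have hbx := hB.1.1.1
  have haS := hA.1.1.2
  have hbS := hB.1.1.2
  simp only [Finset.insert_comm x]
  refine hf (insert x D) a b (by simp [*]) (by simp [*]) hab ?_ ?_ <;>
    rw [Finset.mem_powersetCard, Finset.card_insert_of_notMem (by simp [*]),
      Finset.card_insert_of_notMem hxD] <;>
    exact ⟨by simp [Finset.insert_subset_iff, *], by omega⟩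

/-- Concentration for functions of a uniformly random `k`-subset. -/
theorem SwapLipschitz.sum_exp_le {α : Type*} [DecidableEq α] {c : ℝ} (hc0 : 0 ≤ c) (k : ℕ) :
    ∀ (S : Finset α) (f : Finset α → ℝ), SwapLipschitz S k f c →
      ∑ B ∈ S.powersetCard k, Real.exp (f B)
        ≤ (S.powersetCard k).card *
          Real.exp ((∑ B ∈ S.powersetCard k, f B) / (S.powersetCard k).card + k * (c ^ 2 / 2)) := by
  induction k with
  | zero => intro S f _; simp
  | succ k ih =>
    intro S f hf
    rcases (S.powersetCard (k + 1)).eq_empty_or_nonempty with he | hne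
    · simp [he]
    have hcard : k + 1 ≤ S.card := Finset.powersetCard_nonempty.1 hne
    set P : ℝ := ((S.card - 1).choose k : ℝ) with hP
    have hPc : ∀ x ∈ S, (((S.erase x).powersetCard k).card : ℝ) = P := fun x hx => by
      rw [Finset.card_powersetCard, Finset.card_erase_of_mem hx]
    have hPpos : 0 < P := by
      rw [hP]; exact_mod_cast Nat.choose_pos (by omega)
    set N : ℝ := ((S.powersetCard (k + 1)).card : ℝ) with hN
    have hNpos : 0 < N := by rw [hN]; exact_mod_cast hne.card_pos
    have hNP : (k + 1 : ℝ) * N = S.card * P := by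
      have := sum_sum_powersetCard_erase S k (fun _ => 1)
      simp only [Finset.sum_const, nsmul_eq_mul, mul_one] at this
      rw [hN, ← this, Finset.sum_congr rfl hPc]; simp
    set h : α → ℝ := fun x => (∑ B ∈ (S.erase x).powersetCard k, f (insert x B)) / P with hh
    have hosc : ∀ x ∈ S, ∀ y ∈ S, |h x - h y| ≤ c := by
      intro x hx y hy
      have := hf.abs_sum_sub_sum_le hc0 hx hy
      rw [hPc x hx] at this
      rw [hh]; dsimp only
      rw [← sub_div, abs_div, abs_of_pos hPpos, div_le_iff₀ hPpos]
      linarith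
    have hmean : (∑ x ∈ S, h x) / S.card = (∑ B ∈ S.powersetCard (k + 1), f B) / N := by
      have hS : (0 : ℝ) < S.card := by exact_mod_cast (by omega : 0 < S.card)
      have := sum_sum_powersetCard_erase S k f
      rw [hh, ← Finset.sum_div, this, div_div, div_eq_div_iff (by positivity) (by positivity)]
      linear_combination (∑ B ∈ S.powersetCard (k + 1), f B) * hNP
    have hk : (0 : ℝ) < k + 1 := by positivity
    refine le_of_mul_le_mul_left ?_ hk
    rw [← sum_sum_powersetCard_erase S k (fun B => Real.exp (f B))]
    calc ∑ x ∈ S, ∑ B ∈ (S.erase x).powersetCard k, Real.exp (f (insert x B))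
        ≤ ∑ x ∈ S, P * Real.exp (h x + k * (c ^ 2 / 2)) := by
          refine Finset.sum_le_sum fun x hx => ?_
          have := ih (S.erase x) _ (hf.erase hx)
          rwa [hPc x hx] at this
      _ = P * Real.exp (k * (c ^ 2 / 2)) * ∑ x ∈ S, Real.exp (h x) := by
          rw [Finset.mul_sum]
          refine Finset.sum_congr rfl fun x _ => ?_
          rw [Real.exp_add]; ring
      _ ≤ P * Real.exp (k * (c ^ 2 / 2)) *
          (S.card * Real.exp ((∑ x ∈ S, h x) / S.card + c ^ 2 / 2)) := by
          gcongr
          exact sum_exp_le_of_oscillation_le S h c hosc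
      _ = (S.card * P) * Real.exp ((∑ x ∈ S, h x) / S.card + (k + 1 : ℕ) * (c ^ 2 / 2)) := by
          have : (∑ x ∈ S, h x) / S.card + (k + 1 : ℕ) * (c ^ 2 / 2)
            = k * (c ^ 2 / 2) + ((∑ x ∈ S, h x) / S.card + c ^ 2 / 2) := by push_cast; ring
          rw [this, Real.exp_add (k * (c ^ 2 / 2))]; ring
      _ = _ := by rw [← hNP, hmean]; ring

/-- The trees on `V` with degree sequence `x`. -/
noncomputable def treesOn {V : Type} [Fintype V] (x : V → ℕ) : Finset (SimpleGraph V) :=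
  Finset.univ.filter (fun T => T.IsTree ∧ ∀ j, T.degree j = x j)

theorem mem_treesOn {V : Type} [Fintype V] {x : V → ℕ}
    (hx : ∑ v, x v + 2 = 2 * Fintype.card V) {T : SimpleGraph V} :
    T ∈ treesOn x ↔ T.Connected ∧ ∀ j, T.degree j = x j := by
  simp only [treesOn, Finset.mem_filter, Finset.mem_univ, true_and]
  refine and_congr_left fun hdeg => ⟨fun h => h.1, fun h => ?_⟩
  rw [SimpleGraph.isTree_iff_connected_and_card]
  refine ⟨h, ?_⟩
  have h1 := T.sum_degrees_eq_twice_card_edges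
  simp only [hdeg] at h1
  rw [Nat.card_eq_fintype_card, Nat.card_eq_fintype_card, ← SimpleGraph.edgeFinset_card]
  omega

theorem treesOn_eq_empty {V : Type} [Fintype V] {x : V → ℕ} (hV : 2 ≤ Fintype.card V) {u : V}
    (hu : x u = 0) : treesOn x = ∅ := by
  refine Finset.eq_empty_of_forall_notMem fun T hT => ?_
  simp only [treesOn, Finset.mem_filter, Finset.mem_univ, true_and] at hT
  have : Nontrivial V := Fintype.one_lt_card_iff_nontrivial.1 hV
  have := hT.1.1.preconnected.degree_pos_of_nontrivial u
  have := hT.2 u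
  omega

theorem adj_of_card_eq_two {V : Type} [Fintype V] {x : V → ℕ} (hV : Fintype.card V = 2)
    {T : SimpleGraph V} (hT : T ∈ treesOn x) {a b : V} (hab : a ≠ b) : T.Adj a b := by
  simp only [treesOn, Finset.mem_filter, Finset.mem_univ, true_and] at hT
  have : Nontrivial V := Fintype.one_lt_card_iff_nontrivial.1 (by omega)
  have := hT.1.1.preconnected.degree_pos_of_nontrivial a
  obtain ⟨c, hc⟩ := (T.degree_pos_iff_exists_adj a).1 this
  have hcb : c = b := by
    by_contra hcb
    have h3 : ({a, b, c} : Finset V).card = 3 := by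
      rw [Finset.card_eq_three]; exact ⟨a, b, c, hab, hc.ne, Ne.symm hcb, rfl⟩
    have := Finset.card_le_univ ({a, b, c} : Finset V)
    omega
  exact hcb ▸ hc

/-- Attach the vertex `v` as a leaf to the vertex `u` of a graph on the remaining vertices. -/
def attachLeaf {V : Type} (v : V) (u : {w : V // w ≠ v}) (T : SimpleGraph {w : V // w ≠ v}) :
    SimpleGraph V where
  Adj a b := (∃ ha hb, T.Adj ⟨a, ha⟩ ⟨b, hb⟩) ∨ (a = v ∧ b = u) ∨ (a = u ∧ b = v)
  symm := ⟨by
    rintro a b (⟨ha, hb, h⟩ | ⟨ha, hb⟩ | ⟨ha, hb⟩)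
    · exact Or.inl ⟨hb, ha, h.symm⟩
    · exact Or.inr (Or.inr ⟨hb, ha⟩)
    · exact Or.inr (Or.inl ⟨hb, ha⟩)⟩
  loopless := ⟨by
    rintro a (⟨ha, hb, h⟩ | ⟨ha, hb⟩ | ⟨ha, hb⟩)
    · exact h.ne rfl
    · exact u.2 (hb.symm.trans ha)
    · exact u.2 (ha.symm.trans hb)⟩

theorem attachLeaf_adj_leaf {V : Type} {v : V} {u : {w : V // w ≠ v}}
    {T : SimpleGraph {w : V // w ≠ v}} {b : V} : (attachLeaf v u T).Adj v b ↔ b = u := by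
  have := u.2
  constructor
  · rintro (⟨ha, hb, h⟩ | ⟨ha, hb⟩ | ⟨ha, hb⟩)
    · exact absurd rfl ha
    · exact hb
    · exact absurd ha.symm this
  · rintro rfl
    exact Or.inr (Or.inl ⟨rfl, rfl⟩)

theorem attachLeaf_adj_coe {V : Type} {v : V} {u : {w : V // w ≠ v}}
    {T : SimpleGraph {w : V // w ≠ v}} {a b : {w : V // w ≠ v}} :
    (attachLeaf v u T).Adj a b ↔ T.Adj a b := by
  constructor
  · rintro (⟨ha, hb, h⟩ | ⟨ha, hb⟩ | ⟨ha, hb⟩)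
    · exact h
    · exact absurd ha a.2
    · exact absurd hb b.2
  · intro h
    exact Or.inl ⟨a.2, b.2, h⟩

/-- The graph obtained by deleting the vertex `v`. -/
def deleteVertex {V : Type} (T : SimpleGraph V) (v : V) : SimpleGraph {w : V // w ≠ v} :=
  T.comap (fun w => (w : V))

theorem deleteVertex_attachLeaf {V : Type} {v : V} {u : {w : V // w ≠ v}}
    {T : SimpleGraph {w : V // w ≠ v}} :
    deleteVertex (attachLeaf v u T) v = T := by
  ext a b
  exact attachLeaf_adj_coe

theorem attachLeaf_deleteVertex {V : Type} {v : V} {u : {w : V // w ≠ v}} {T : SimpleGraph V}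
    (hv : ∀ b, T.Adj v b ↔ b = u) :
    attachLeaf v u (deleteVertex T v) = T := by
  ext a b
  by_cases ha : a = v
  · subst ha
    rw [attachLeaf_adj_leaf, hv]
  by_cases hb : b = v
  · subst hb
    rw [SimpleGraph.adj_comm, attachLeaf_adj_leaf, SimpleGraph.adj_comm, hv]
  · exact attachLeaf_adj_coe (a := ⟨a, ha⟩) (b := ⟨b, hb⟩)

/-- The degree sequence after deleting a leaf attached to `u`. -/
noncomputable def dropLeaf {V : Type} {v : V} (x : V → ℕ) (u w : {w : V // w ≠ v}) : ℕ :=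
  x w - if w = u then 1 else 0

theorem sum_dropLeaf {V : Type} [Fintype V] {v : V} {x : V → ℕ} (hpos : ∀ w, 1 ≤ x w)
    (hv : x v = 1) (u : {w : V // w ≠ v}) : ∑ w, x w = ∑ w, dropLeaf x u w + 2 := by
  have h1 : ∑ w : {w : V // w ≠ v}, x w
      = ∑ w, (dropLeaf x u w + if w = u then 1 else 0) := by
    refine Finset.sum_congr rfl fun w _ => ?_
    have := hpos w
    unfold dropLeaf
    split_ifs <;> omega
  rw [Fintype.sum_eq_add_sum_subtype_ne x v, hv, h1, Finset.sum_add_distrib]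
  simp
  omega

theorem card_ne_add_one {V : Type} [Fintype V] (v : V) :
    Fintype.card {w : V // w ≠ v} + 1 = Fintype.card V := by
  have := Fintype.card_pos_iff.2 ⟨v⟩
  rw [Fintype.card_subtype_compl, Fintype.card_subtype_eq]
  omega

theorem degree_eq_sum {V : Type} [Fintype V] (T : SimpleGraph V) (w : V) :
    T.degree w = ∑ b, if T.Adj w b then 1 else 0 := by
  rw [Finset.sum_boole, ← SimpleGraph.card_neighborFinset_eq_degree,
    SimpleGraph.neighborFinset_eq_filter]
  simp

theorem degree_leaf {V : Type} [Fintype V] {v : V} {u : {w : V // w ≠ v}} {T : SimpleGraph V}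
    (hv : ∀ b, T.Adj v b ↔ b = u) : T.degree v = 1 := by
  rw [degree_eq_sum]; simp [hv]

theorem degree_deleteVertex {V : Type} [Fintype V] {v : V} {u : {w : V // w ≠ v}}
    {T : SimpleGraph V} (hv : ∀ b, T.Adj v b ↔ b = u) (w : {w : V // w ≠ v}) :
    T.degree w = (deleteVertex T v).degree w
      + if w = u then 1 else 0 := by
  rw [degree_eq_sum, degree_eq_sum, Fintype.sum_eq_add_sum_subtype_ne _ v, SimpleGraph.adj_comm,
    hv, add_comm]
  simp [Subtype.ext_iff, deleteVertex]

theorem mem_treesOn_iff_deleteVertex {V : Type} [Fintype V] {v : V} {x : V → ℕ}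
    (hsum : ∑ v, x v + 2 = 2 * Fintype.card V) (hpos : ∀ w, 1 ≤ x w) (hxv : x v = 1)
    {u : {w : V // w ≠ v}} {T : SimpleGraph V} (hv : ∀ b, T.Adj v b ↔ b = u) :
    T ∈ treesOn x ↔
      deleteVertex T v ∈ treesOn (dropLeaf x u) := by
  have hc := card_ne_add_one v
  have hs := sum_dropLeaf hpos hxv u
  rw [mem_treesOn hsum, mem_treesOn (by omega)]
  refine and_congr ⟨fun h => ?_, fun h => ?_⟩ ⟨fun h w => ?_, fun h w => ?_⟩
  · have : (T.induce {w | w ≠ v}).Preconnected := by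
      refine h.preconnected.induce_of_degree_eq_one fun w hw => ?_
      have : w = v := by simpa using hw
      subst this
      intro a ha b hb
      rw [SimpleGraph.mem_neighborSet, hv] at ha hb
      rw [ha, hb]
    have hne : Nonempty {w : V // w ≠ v} := ⟨u⟩
    exact { preconnected := this, nonempty := hne }
  · have hreach : ∀ a b : {w : V // w ≠ v}, T.Reachable a b := fun a b =>
      SimpleGraph.Reachable.map
      (⟨fun w => (w : V), fun h => h⟩ : deleteVertex T v →g T) (h.preconnected a b)
    have hu : ∀ a, T.Reachable a u := fun a => by
      by_cases ha : a = v
      · subst ha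
        exact ((hv u).2 rfl).reachable
      · exact hreach ⟨a, ha⟩ u
    have : Nonempty V := ⟨v⟩
    exact { preconnected := fun a b => (hu a).trans (hu b).symm, nonempty := this }
  · have := degree_deleteVertex hv w
    have h2 := h w
    have := hpos w
    unfold dropLeaf
    omega
  · by_cases hw : w = v
    · subst hw
      rw [degree_leaf hv, hxv]
    · have h1 := degree_deleteVertex hv ⟨w, hw⟩
      have h2 := h ⟨w, hw⟩
      have := hpos w
      simp only [dropLeaf] at h1 h2
      split_ifs at h1 h2 <;> omega

/-- Summation over trees by deleting a fixed leaf. -/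
theorem sum_treesOn_eq_sum_attachLeaf {V : Type} [Fintype V] {v : V} {x : V → ℕ}
    (hsum : ∑ v, x v + 2 = 2 * Fintype.card V) (hpos : ∀ w, 1 ≤ x w) (hxv : x v = 1)
    (φ : SimpleGraph V → ℝ) :
    ∑ T ∈ treesOn x, φ T
      = ∑ u : {w : V // w ≠ v}, ∑ T ∈ treesOn (dropLeaf x u), φ (attachLeaf v u T) := by
  rw [Finset.sum_sigma']
  symm
  refine Finset.sum_bij (fun p _ => attachLeaf v p.1 p.2) ?_ ?_ ?_ ?_
  · rintro ⟨u, T⟩ h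
    rw [mem_treesOn_iff_deleteVertex hsum hpos hxv (fun b => attachLeaf_adj_leaf), deleteVertex_attachLeaf]
    simpa using h
  · rintro ⟨u, T⟩ - ⟨u', T'⟩ - h
    dsimp only at h
    have hu : u = u' := by
      have h1 : (attachLeaf v u T).Adj v u := attachLeaf_adj_leaf.2 rfl
      rw [h] at h1
      exact Subtype.ext (attachLeaf_adj_leaf.1 h1)
    subst hu
    have hT : T = T' := by
      have := congrArg (deleteVertex · v) h
      simpa only [deleteVertex_attachLeaf] using this
    subst hT
    rfl
  · intro T hT
    have hdeg := ((mem_treesOn hsum).1 hT).2 v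
    rw [hxv, SimpleGraph.degree_eq_one_iff_existsUnique_adj] at hdeg
    obtain ⟨u, hu, huniq⟩ := hdeg
    have hv : ∀ b, T.Adj v b ↔ b = u := fun b => ⟨huniq b, fun h => h ▸ hu⟩
    have hv' : ∀ b, T.Adj v b ↔ b = (⟨u, hu.ne'⟩ : {w : V // w ≠ v}) := hv
    refine ⟨⟨⟨u, hu.ne'⟩, deleteVertex T v⟩, ?_, ?_⟩
    · simpa using (mem_treesOn_iff_deleteVertex hsum hpos hxv hv').1 hT
    · exact attachLeaf_deleteVertex hv'
  · intros; rfl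

theorem sum_dropLeaf_mul_prod_factorial {V : Type} [Fintype V] {v : V} {x : V → ℕ}
    (hV : 3 ≤ Fintype.card V) (hpos : ∀ w, 1 ≤ x w) (hxv : x v = 1)
    (u : {w : V // w ≠ v}) (ψ : SimpleGraph {w : V // w ≠ v} → ℝ) (c : ℝ)
    (hc : (∀ w, 1 ≤ dropLeaf x u w) →
      (∑ T ∈ treesOn (dropLeaf x u), ψ T) * ∏ w, ((dropLeaf x u w - 1).factorial : ℝ) = c) :
    (∑ T ∈ treesOn (dropLeaf x u), ψ T) * ∏ w, ((x w - 1).factorial : ℝ)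
      = ((x u : ℝ) - 1) * c := by
  have hcard := card_ne_add_one v
  rcases (hpos u).eq_or_lt with h1 | h2
  · rw [treesOn_eq_empty (by omega) (u := u) (by simp [dropLeaf, ← h1])]
    simp [← h1]
  · have hpos' : ∀ w, 1 ≤ dropLeaf x u w := fun w => by
      have := hpos w
      unfold dropLeaf
      split_ifs with h
      · subst h; omega
      · omega
    have hprod : ∏ w, ((x w - 1).factorial : ℝ)
        = ((x u : ℝ) - 1) * ∏ w, ((dropLeaf x u w - 1).factorial : ℝ) := by
      rw [Fintype.prod_eq_mul_prod_subtype_ne _ v, hxv, Fintype.prod_eq_mul_prod_subtype_ne _ u,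
        Fintype.prod_eq_mul_prod_subtype_ne (fun w => ((dropLeaf x u w - 1).factorial : ℝ)) u]
      have h3 : ((x u - 1).factorial : ℝ)
          = ((x u : ℝ) - 1) * ((dropLeaf x u u - 1).factorial : ℝ) := by
        obtain ⟨m, hm⟩ : ∃ m, x u = m + 2 := ⟨x u - 2, by omega⟩
        simp only [dropLeaf, hm, if_true]
        rw [show m + 2 - 1 = m + 1 by omega, show m + 1 - 1 = m by omega, Nat.factorial_succ]
        push_cast
        ring
      have h4 : ∀ w : {w : {w : V // w ≠ v} // w ≠ u}, dropLeaf x u w = x w := fun w => by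
        simp [dropLeaf, w.2]
      rw [h3]
      simp only [h4]
      simp
      ring
    rw [hprod, ← hc hpos']
    ring

theorem exists_leaf {V : Type} [Fintype V] {x : V → ℕ}
    (hsum : ∑ v, x v + 2 = 2 * Fintype.card V) (hpos : ∀ w, 1 ≤ x w) : ∃ v, x v = 1 := by
  by_contra! h
  have : ∑ v : V, 2 ≤ ∑ v, x v := Finset.sum_le_sum fun v _ => by
    have := hpos v
    have := h v
    omega
  simp at this
  omega

theorem sum_ne_leaf {V : Type} [Fintype V] {v : V} {x : V → ℕ} {n : ℕ}
    (hV : Fintype.card V = n + 3) (hsum : ∑ v, x v + 2 = 2 * Fintype.card V) (hxv : x v = 1) :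
    ∑ u : {w : V // w ≠ v}, ((x u : ℝ) - 1) = n + 1 := by
  have hcard := card_ne_add_one v
  have h1 := Fintype.sum_eq_add_sum_subtype_ne x v
  have h2 : ∑ u : {w : V // w ≠ v}, x u = 2 * n + 3 := by omega
  rw [Finset.sum_sub_distrib, ← Nat.cast_sum, h2]
  simp only [Finset.sum_const, Finset.card_univ, nsmul_eq_mul]
  rw [show Fintype.card {w : V // w ≠ v} = n + 2 by omega]
  push_cast
  ring

/-- The number of trees with a prescribed degree sequence. -/
theorem card_treesOn_mul_prod_factorial (n : ℕ) : ∀ (V : Type) [Fintype V] (x : V → ℕ),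
    Fintype.card V = n + 2 → (∀ v, 1 ≤ x v) → ∑ v, x v + 2 = 2 * Fintype.card V →
      ((treesOn x).card : ℝ) * ∏ v, ((x v - 1).factorial : ℝ) = n.factorial := by
  induction n with
  | zero =>
    intro V _ x hV hpos hsum
    have hx : ∀ v, x v = 1 := by
      have h1 : ∑ v : V, 1 = ∑ v, x v := by simp; omega
      exact fun v => ((Finset.sum_eq_sum_iff_of_le (fun v _ => hpos v)).1 h1 v
        (Finset.mem_univ v)).symm
    have hT : treesOn x = {⊤} := by
      have : Nontrivial V := Fintype.one_lt_card_iff_nontrivial.1 (by omega)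
      refine Finset.eq_singleton_iff_unique_mem.2 ⟨?_, fun T hT => ?_⟩
      · rw [mem_treesOn hsum]
        refine ⟨SimpleGraph.connected_top, fun j => ?_⟩
        have := SimpleGraph.complete_graph_degree j
        rw [hx]
        rw [hV] at this
        convert! this
      · ext a b
        exact ⟨fun h => h.ne, fun h => adj_of_card_eq_two hV hT h⟩
    simp [hT, hx]
  | succ n ih =>
    intro V _ x hV hpos hsum
    obtain ⟨v, hv⟩ := exists_leaf hsum hpos
    have hcard := card_ne_add_one v
    have hrec := sum_treesOn_eq_sum_attachLeaf hsum hpos hv (fun _ => 1)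
    have h1 : ((treesOn x).card : ℝ) = ∑ T ∈ treesOn x, (1 : ℝ) := by simp
    rw [h1, hrec, Finset.sum_mul]
    have h2 : ∀ u : {w : V // w ≠ v}, (∑ T ∈ treesOn (dropLeaf x u), (1 : ℝ)) *
        ∏ w, ((x w - 1).factorial : ℝ) = ((x u : ℝ) - 1) * n.factorial := fun u => by
      refine sum_dropLeaf_mul_prod_factorial (by omega) hpos hv u _ _ fun hpos' => ?_
      have hs := sum_dropLeaf hpos hv u
      simpa using ih _ (dropLeaf x u) (by omega) hpos' (by omega)
    rw [Finset.sum_congr rfl fun u _ => h2 u, ← Finset.sum_mul, sum_ne_leaf (by omega) hsum hv,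
      Nat.factorial_succ]
    push_cast
    ring

theorem sum_adj_mul_prod_factorial_of_leaf {V : Type} [Fintype V] {v : V} {x : V → ℕ}
    (hV : 3 ≤ Fintype.card V) (hsum : ∑ v, x v + 2 = 2 * Fintype.card V) (hpos : ∀ w, 1 ≤ x w)
    (hxv : x v = 1) (i j : {w : V // w ≠ v}) (c : {w : V // w ≠ v} → ℝ)
    (hc : ∀ u, (∀ w, 1 ≤ dropLeaf x u w) →
      (∑ T ∈ treesOn (dropLeaf x u), if T.Adj i j then (1 : ℝ) else 0) *
        ∏ w, ((dropLeaf x u w - 1).factorial : ℝ) = c u) :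
    (∑ T ∈ treesOn x, if T.Adj i j then (1 : ℝ) else 0) * ∏ v, ((x v - 1).factorial : ℝ)
      = ∑ u : {w : V // w ≠ v}, ((x u : ℝ) - 1) * c u := by
  rw [sum_treesOn_eq_sum_attachLeaf hsum hpos hxv, Finset.sum_mul]
  refine Finset.sum_congr rfl fun u _ => ?_
  simp only [attachLeaf_adj_coe]
  exact sum_dropLeaf_mul_prod_factorial hV hpos hxv u _ _ (hc u)

theorem sum_adj_eq_zero_of_leaves {V : Type} [Fintype V] {x : V → ℕ}
    (hV : 3 ≤ Fintype.card V) (hsum : ∑ v, x v + 2 = 2 * Fintype.card V) (hpos : ∀ w, 1 ≤ x w)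
    {i j : V} (hi : x i = 1) (hj : x j = 1) :
    (∑ T ∈ treesOn x, if T.Adj i j then (1 : ℝ) else 0) = 0 := by
  have hcard := card_ne_add_one i
  rw [sum_treesOn_eq_sum_attachLeaf hsum hpos hi]
  refine Finset.sum_eq_zero fun u _ => ?_
  simp only [attachLeaf_adj_leaf]
  by_cases hu : j = u
  · rw [treesOn_eq_empty (by omega) (u := u) (by simp [dropLeaf, ← hu, hj])]
    simp
  · simp [hu]

theorem exists_leaf_or_leaves {V : Type} [Fintype V] {x : V → ℕ}
    (hsum : ∑ v, x v + 2 = 2 * Fintype.card V) (hpos : ∀ w, 1 ≤ x w) {i j : V} (hij : i ≠ j) :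
    (∃ v, v ≠ i ∧ v ≠ j ∧ x v = 1) ∨ (x i = 1 ∧ x j = 1) := by
  by_contra! h
  obtain ⟨h1, h2⟩ := h
  have hi := hpos i
  have hj := hpos j
  have h4 : 3 ≤ x i + x j := by omega
  have h5 : ∑ v : V, 2 < ∑ v, (x v + ((if v = i then 1 else 0) + if v = j then 1 else 0)) := by
    have hle : ∀ v ∈ Finset.univ,
        2 ≤ x v + ((if v = i then 1 else 0) + if v = j then 1 else 0) := fun v _ => by
      have := hpos v
      by_cases hvi : v = i
      · simp [hvi]; have := hpos i; omega
      by_cases hvj : v = j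
      · simp [hvj]; have := hpos j; omega
      have := h1 v hvi hvj
      omega
    by_cases hi1 : x i = 1
    · refine Finset.sum_lt_sum hle ⟨j, Finset.mem_univ _, ?_⟩
      simp [hij.symm]; omega
    · refine Finset.sum_lt_sum hle ⟨i, Finset.mem_univ _, ?_⟩
      simp [hij]; omega
  simp [Finset.sum_add_distrib] at h5
  omega

/-- The number of trees with a prescribed degree sequence that contain a given edge. -/
theorem sum_adj_mul_prod_factorial (n : ℕ) : ∀ (V : Type) [Fintype V] (x : V → ℕ),
    Fintype.card V = n + 3 → (∀ v, 1 ≤ x v) → ∑ v, x v + 2 = 2 * Fintype.card V →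
      ∀ i j : V, i ≠ j →
      (∑ T ∈ treesOn x, if T.Adj i j then (1 : ℝ) else 0) * ∏ v, ((x v - 1).factorial : ℝ)
        = n.factorial * ((x i : ℝ) + x j - 2) := by
  induction n with
  | zero =>
    intro V _ x hV hpos hsum i j hij
    rcases exists_leaf_or_leaves hsum hpos hij with ⟨v, hvi, hvj, hv⟩ | ⟨hi, hj⟩
    · have hcard := card_ne_add_one v
      rw [sum_adj_mul_prod_factorial_of_leaf (by omega) hsum hpos hv ⟨i, hvi.symm⟩ ⟨j, hvj.symm⟩
        (fun _ => 1) fun u hpos' => ?_]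
      · have h1 := sum_ne_leaf (n := 0) hV hsum hv
        have hset : (Finset.univ : Finset V) = {v, i, j} := by
          symm
          apply Finset.eq_univ_of_card
          rw [hV, Finset.card_eq_three]
          exact ⟨v, i, j, hvi, hvj, hij, rfl⟩
        rw [hset, Finset.sum_insert (by simp [hvi, hvj]), Finset.sum_insert (by simp [hij]),
          Finset.sum_singleton] at hsum
        have h3 : x i + x j = 3 := by omega
        have h4 : (x i : ℝ) + x j = 3 := by exact_mod_cast h3
        simp only [mul_one]
        rw [h1, h4]
        norm_num
      · have hs := sum_dropLeaf hpos hv u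
        have := card_treesOn_mul_prod_factorial 0 _ (dropLeaf x u) (by omega) hpos' (by omega)
        rw [Finset.sum_congr rfl fun T hT => if_pos (adj_of_card_eq_two (by omega) hT
          (fun h => hij (congrArg Subtype.val h)))]
        simpa using this
    · rw [sum_adj_eq_zero_of_leaves (by omega) hsum hpos hi hj, hi, hj]
      norm_num
  | succ n ih =>
    intro V _ x hV hpos hsum i j hij
    rcases exists_leaf_or_leaves hsum hpos hij with ⟨v, hvi, hvj, hv⟩ | ⟨hi, hj⟩
    · have hcard := card_ne_add_one v
      have hdrop : ∀ u w : {w : V // w ≠ v},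
          (dropLeaf x u w : ℝ) = x w - if u = w then 1 else 0 := fun u w => by
        have := hpos w
        unfold dropLeaf
        rw [Nat.cast_sub (by split_ifs <;> omega)]
        simp [eq_comm]
      rw [sum_adj_mul_prod_factorial_of_leaf (by omega) hsum hpos hv ⟨i, hvi.symm⟩ ⟨j, hvj.symm⟩
        (fun u => n.factorial * ((dropLeaf x u ⟨i, hvi.symm⟩ : ℝ)
          + dropLeaf x u ⟨j, hvj.symm⟩ - 2)) fun u hpos' => ?_]
      · have h1 := sum_ne_leaf (n := n + 1) hV hsum hv
        have h2 : ∀ u : {w : V // w ≠ v}, ((x u : ℝ) - 1) * (n.factorial *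
            ((dropLeaf x u ⟨i, hvi.symm⟩ : ℝ) + dropLeaf x u ⟨j, hvj.symm⟩ - 2))
            = n.factorial * ((x i : ℝ) + x j - 2) * ((x u : ℝ) - 1)
              - n.factorial * ((if u = ⟨i, hvi.symm⟩ then ((x u : ℝ) - 1) else 0)
                + if u = ⟨j, hvj.symm⟩ then ((x u : ℝ) - 1) else 0) := fun u => by
          rw [hdrop, hdrop]
          split_ifs <;> ring
        rw [Finset.sum_congr rfl fun u _ => h2 u, Finset.sum_sub_distrib, ← Finset.mul_sum, h1,
          ← Finset.mul_sum, Finset.sum_add_distrib, Nat.factorial_succ]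
        simp only [Finset.sum_ite_eq', Finset.mem_univ, if_true]
        push_cast
        ring
      · have hs := sum_dropLeaf hpos hv u
        exact ih _ (dropLeaf x u) (by omega) hpos' (by omega) _ _
          (fun h => hij (congrArg Subtype.val h))
    · rw [sum_adj_eq_zero_of_leaves (by omega) hsum hpos hi hj, hi, hj]
      norm_num

theorem sum_edgeFinset_eq {V : Type} [Fintype V] (T : SimpleGraph V) [Fintype T.edgeSet]
    (F : Sym2 V → ℝ) :
    2 * ∑ e ∈ T.edgeFinset, F e = ∑ i, ∑ j, (if T.Adj i j then 1 else 0) * F s(i, j) := by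
  rw [← Finset.sum_product']
  simp only [ite_mul, one_mul, zero_mul]
  rw [← Finset.sum_filter, ← Finset.sum_fiberwise_of_maps_to (t := T.edgeFinset)
    (g := fun p : V × V => s(p.1, p.2)) (by rintro ⟨a, b⟩ h; simpa using h), Finset.mul_sum]
  refine Finset.sum_congr rfl fun e he => ?_
  induction e using Sym2.ind with
  | _ a b =>
    have hab : T.Adj a b := by simpa using he
    have : Finset.filter (fun p : V × V => s(p.1, p.2) = s(a, b))
        (Finset.filter (fun p : V × V => T.Adj p.1 p.2) (Finset.univ ×ˢ Finset.univ))
        = {(a, b), (b, a)} := by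
      ext ⟨c, d⟩
      simp only [Finset.mem_filter, Finset.mem_product, Finset.mem_univ, true_and,
        Finset.mem_insert, Finset.mem_singleton, Prod.mk.injEq, Sym2.eq_iff]
      constructor
      · exact fun h => h.2
      · rintro (⟨rfl, rfl⟩ | ⟨rfl, rfl⟩)
        · exact ⟨hab, Or.inl ⟨rfl, rfl⟩⟩
        · exact ⟨hab.symm, Or.inr ⟨rfl, rfl⟩⟩
    rw [this, Finset.sum_pair (by simp [hab.ne])]
    simp only [Sym2.eq_swap (a := b) (b := a)]
    ring

/-- Weighted edge sums averaged over trees with a prescribed degree sequence. -/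
theorem sum_treesOn_sum_edgeFinset {V : Type} [Fintype V] (n : ℕ) (x : V → ℕ)
    (hV : Fintype.card V = n + 3) (hpos : ∀ w, 1 ≤ x w)
    (hsum : ∑ v, x v + 2 = 2 * Fintype.card V) (a : V → ℝ) (F : Sym2 V → ℝ)
    (hF : ∀ i j, F s(i, j) = a i * a j) :
    (n + 1) * ∑ T ∈ treesOn x, ∑ e ∈ T.edgeFinset, F e
      = (treesOn x).card * ∑ i, a i * ((x i : ℝ) - 1) * (∑ j, a j - a i) := by
  have hprod : (0 : ℝ) < ∏ v, ((x v - 1).factorial : ℝ) :=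
    Finset.prod_pos fun v _ => by exact_mod_cast Nat.factorial_pos _
  have hN := card_treesOn_mul_prod_factorial (n + 1) V x (by omega) hpos hsum
  have hE : ∀ i j, (n + 1 : ℝ) * (∑ T ∈ treesOn x, if T.Adj i j then (1 : ℝ) else 0)
      = (treesOn x).card * (((x i : ℝ) + x j - 2) - if i = j then (2 * (x i : ℝ) - 2) else 0) := by
    intro i j
    by_cases hij : i = j
    · subst hij
      simp
      ring_nf
      simp
    · have h1 := sum_adj_mul_prod_factorial n V x hV hpos hsum i j hij
      rw [if_neg hij, sub_zero]
      refine mul_right_cancel₀ hprod.ne' ?_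
      rw [Nat.factorial_succ] at hN
      push_cast at hN
      linear_combination (n + 1 : ℝ) * h1 - ((x i : ℝ) + x j - 2) * hN
  have h2 : 2 * ∑ T ∈ treesOn x, ∑ e ∈ T.edgeFinset, F e
      = ∑ i, ∑ j, (a i * a j) * ∑ T ∈ treesOn x, if T.Adj i j then (1 : ℝ) else 0 := by
    rw [Finset.mul_sum, Finset.sum_congr rfl fun T _ => sum_edgeFinset_eq T F, Finset.sum_comm]
    refine Finset.sum_congr rfl fun i _ => ?_
    rw [Finset.sum_comm]
    refine Finset.sum_congr rfl fun j _ => ?_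
    rw [Finset.mul_sum]
    refine Finset.sum_congr rfl fun T _ => ?_
    rw [hF]; ring
  have h3 : (n + 1 : ℝ) * (2 * ∑ T ∈ treesOn x, ∑ e ∈ T.edgeFinset, F e)
      = (treesOn x).card * ∑ i, ∑ j, (a i * a j) *
        (((x i : ℝ) + x j - 2) - if i = j then (2 * (x i : ℝ) - 2) else 0) := by
    rw [h2]
    simp only [Finset.mul_sum (a := (n + 1 : ℝ)), Finset.mul_sum (a := ((treesOn x).card : ℝ))]
    refine Finset.sum_congr rfl fun i _ => Finset.sum_congr rfl fun j _ => ?_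
    linear_combination (a i * a j) * hE i j
  have h4 : ∑ i, ∑ j, (a i * a j) *
      (((x i : ℝ) + x j - 2) - if i = j then (2 * (x i : ℝ) - 2) else 0)
      = 2 * ∑ i, a i * ((x i : ℝ) - 1) * (∑ j, a j - a i) := by
    have h5 : ∀ i j, (a i * a j) * (((x i : ℝ) + x j - 2) - if i = j then (2 * (x i : ℝ) - 2) else 0)
        = (a i * ((x i : ℝ) - 1)) * a j + a i * (a j * ((x j : ℝ) - 1))
          - if i = j then 2 * (a i * ((x i : ℝ) - 1) * a j) else 0 := fun i j => by
      split_ifs <;> ring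
    simp only [h5, Finset.sum_sub_distrib, Finset.sum_add_distrib, Finset.sum_ite_eq,
      Finset.mem_univ, if_true, mul_sub, ← Finset.mul_sum, ← Finset.sum_mul]
    ring
  linear_combination h3 / 2 + ((treesOn x).card : ℝ) / 2 * h4

theorem treesWith_eq_treesOn (n : ℕ) (x : Fin n → ℕ) : treesWith n x = treesOn x := by
  ext T
  simp only [treesWith, treesOn, Finset.mem_filter, Finset.mem_univ, true_and]

theorem davg_sub_two_mul (n : ℕ) (hn : 0 < n) (d : Fin n → ℕ) :
    (davg n d - 2) * n = ∑ j, (d j : ℝ) - 2 * n := by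
  have : (n : ℝ) ≠ 0 := by exact_mod_cast hn.ne'
  unfold davg
  field_simp

/-- `λ` as a function of the residual degrees `y = d - x`, whose sum is `l`. -/
noncomputable def lamResidual {n : ℕ} (l : ℝ) (y : Fin n → ℕ) : ℝ :=
  (∑ j, (y j : ℝ) * (y j - 1)) / (2 * l)

/-- `μ̄` as a function of the residual degrees `y = d - x`, whose sum is `l`. -/
noncomputable def muResidual {n : ℕ} (d : Fin n → ℕ) (l : ℝ) (y : Fin n → ℕ) : ℝ :=
  (∑ j, (y j : ℝ) * (d j - 1 - y j) * (l - y j)) / ((n - 2) * l)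

theorem lamx_eq_lamResidual {n : ℕ} (hn : 0 < n) (d x : Fin n → ℕ) :
    lamx n d x = lamResidual (∑ j, (d j : ℝ) - 2 * n + 2) (fun j => d j - x j) := by
  unfold lamx lamResidual
  rw [davg_sub_two_mul n hn]
  congr 1
  · refine Finset.sum_congr rfl fun j _ => ?_
    rw [Nat.cast_descFactorial_two]
  · ring

theorem mubar_eq_muResidual {n : ℕ} (hn : 3 ≤ n) (d x : Fin n → ℕ) (hpos : ∀ j, 1 ≤ x j)
    (hle : ∀ j, x j ≤ d j) (hsum : ∑ j, x j + 2 = 2 * n)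
    (hl : 0 < ∑ j, (d j : ℝ) - 2 * n + 2) :
    mubar n d x = muResidual d (∑ j, (d j : ℝ) - 2 * n + 2) (fun j => d j - x j) := by
  obtain ⟨m, rfl⟩ : ∃ m, n = m + 3 := ⟨n - 3, by omega⟩
  have hcard : Fintype.card (Fin (m + 3)) = m + 3 := Fintype.card_fin _
  set l : ℝ := ∑ j, (d j : ℝ) - 2 * (m + 3 : ℕ) + 2 with hl'
  have hN := card_treesOn_mul_prod_factorial (m + 1) (Fin (m + 3)) x (by omega) hpos
    (by rw [hcard]; omega)
  have hN0 : ((treesOn x).card : ℝ) ≠ 0 := by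
    intro h
    rw [h, zero_mul] at hN
    exact Nat.factorial_ne_zero (m + 1) (by exact_mod_cast hN.symm)
  have key := sum_treesOn_sum_edgeFinset m x hcard hpos (by rw [hcard]; omega)
    (fun j => ((d j - x j : ℕ) : ℝ))
    (Sym2.lift ⟨fun i j => ((d i - x i : ℕ) : ℝ) * ((d j - x j : ℕ) : ℝ), fun i j => by ring⟩)
    (fun i j => by simp)
  have hsuml : ∑ j, ((d j - x j : ℕ) : ℝ) = l := by
    have h1 : ∑ j, ((d j - x j : ℕ) : ℝ) = ∑ j, (d j : ℝ) - ∑ j, (x j : ℝ) := by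
      rw [← Finset.sum_sub_distrib]
      exact Finset.sum_congr rfl fun j _ => Nat.cast_sub (hle j)
    have h2 : (∑ j, (x j : ℝ)) + 2 = 2 * (m + 3 : ℕ) := by exact_mod_cast hsum
    rw [h1, hl']; linarith
  have hm : (m : ℝ) + 1 ≠ 0 := by positivity
  unfold mubar muT muResidual
  rw [davg_sub_two_mul _ (by omega), ← hl', treesWith_eq_treesOn, ← Finset.sum_div, div_div,
    div_eq_div_iff (mul_ne_zero hl.ne' hN0)
      (mul_ne_zero (by push_cast; intro h; apply hm; linarith) hl.ne')]
  rw [hsuml] at key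
  have hterm : ∑ j, ((d j - x j : ℕ) : ℝ) * ((x j : ℝ) - 1) * (l - ((d j - x j : ℕ) : ℝ))
      = ∑ j, ((d j - x j : ℕ) : ℝ) * ((d j : ℝ) - 1 - ((d j - x j : ℕ) : ℝ))
        * (l - ((d j - x j : ℕ) : ℝ)) := by
    refine Finset.sum_congr rfl fun j _ => ?_
    rw [Nat.cast_sub (hle j)]; ring
  rw [hterm] at key
  push_cast
  linear_combination l * key

theorem abs_sum_sub_sum_le_of_increment {n : ℕ} (φ : Fin n → ℕ → ℝ) (K : ℝ) (z : Fin n → ℕ)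
    (p q : Fin n) (hp : |φ p (z p + 1) - φ p (z p)| ≤ K)
    (hq : |φ q (z q + 1) - φ q (z q)| ≤ K) :
    |∑ j, φ j (z j + if j = p then 1 else 0) - ∑ j, φ j (z j + if j = q then 1 else 0)|
      ≤ 2 * K := by
  have h : ∀ r : Fin n, ∑ j, φ j (z j + if j = r then 1 else 0)
      = ∑ j, φ j (z j) + (φ r (z r + 1) - φ r (z r)) := fun r => by
    have h1 : ∀ j, φ j (z j + if j = r then 1 else 0)
        = φ j (z j) + if j = r then φ j (z j + 1) - φ j (z j) else 0 := fun j => by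
      split_ifs <;> simp
    simp [h1, Finset.sum_add_distrib]
  rw [h, h]
  rw [abs_le] at *
  constructor <;> linarith [hp.1, hp.2, hq.1, hq.2]

theorem lamResidual_nonneg {n : ℕ} {l : ℝ} (hl : 0 < l) (y : Fin n → ℕ) :
    0 ≤ lamResidual l y := by
  refine div_nonneg (Finset.sum_nonneg fun j _ => ?_) (by positivity)
  rcases Nat.eq_zero_or_pos (y j) with h | h
  · simp [h]
  · have : (1 : ℝ) ≤ y j := by exact_mod_cast h
    exact mul_nonneg (by positivity) (by linarith)

theorem lamResidual_le {n : ℕ} {l D : ℝ} (hl : 0 < l) (y : Fin n → ℕ)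
    (hD : ∀ j, (y j : ℝ) ≤ D) (hy : ∑ j, (y j : ℝ) = l) : lamResidual l y ≤ D / 2 := by
  unfold lamResidual
  rw [div_le_iff₀ (by positivity)]
  calc ∑ j, (y j : ℝ) * (y j - 1) ≤ ∑ j, D * (y j : ℝ) := by
        refine Finset.sum_le_sum fun j _ => ?_
        have : (0 : ℝ) ≤ y j := by positivity
        nlinarith [hD j]
    _ = D / 2 * (2 * l) := by rw [← Finset.mul_sum, hy]; ring

/-- Oscillation of the residual form of `g` under moving one unit of residual degree. -/
theorem abs_residual_sub_le {n : ℕ} (hn : 3 ≤ n) (d : Fin n → ℕ) {l D : ℝ} (hD : 1 ≤ D)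
    (hlD : D ^ 2 ≤ l) (hln : l ≤ D * n) (hdD : ∀ j, (d j : ℝ) ≤ D) (z : Fin n → ℕ) (p q : Fin n)
    (hle : ∀ r, r = p ∨ r = q → z r + 2 ≤ d r)
    (hzd : ∀ j, z j + 1 ≤ d j) (hz : ∑ j, (z j : ℝ) + 1 = l) (K : ℝ) :
    |(K - lamResidual l (fun j => z j + if j = p then 1 else 0)
        - lamResidual l (fun j => z j + if j = p then 1 else 0) ^ 2
        - muResidual d l (fun j => z j + if j = p then 1 else 0))
      - (K - lamResidual l (fun j => z j + if j = q then 1 else 0)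
        - lamResidual l (fun j => z j + if j = q then 1 else 0) ^ 2
        - muResidual d l (fun j => z j + if j = q then 1 else 0))| ≤ 16 * D ^ 2 / l := by
  have hl : 0 < l := by nlinarith
  have hn' : (3 : ℝ) ≤ n := by exact_mod_cast hn
  have hzl : ∀ r, (z r : ℝ) ≤ l := fun r => by
    have := Finset.single_le_sum (f := fun j => (z j : ℝ)) (fun j _ => by positivity)
      (Finset.mem_univ r)
    linarith
  have hinc : ∀ r, r = p ∨ r = q → (z r : ℝ) + 2 ≤ d r := fun r hr => by exact_mod_cast hle r hr
  have hsumr : ∀ r : Fin n, ∑ j, ((z j + if j = r then 1 else 0 : ℕ) : ℝ) = l := fun r => by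
    push_cast
    rw [Finset.sum_add_distrib]
    simpa using hz
  have hyD : ∀ r j : Fin n, r = p ∨ r = q → ((z j + if j = r then 1 else 0 : ℕ) : ℝ) ≤ D :=
    fun r j hr => by
      refine le_trans ?_ (hdD j)
      have h1 := hzd j
      have h2 := hle r hr
      split_ifs with h
      · subst h; exact_mod_cast (by omega : z j + 1 ≤ d j)
      · exact_mod_cast (by omega : z j + 0 ≤ d j)
  have hlam1 := abs_sum_sub_sum_le_of_increment (fun _ t => (t : ℝ) * (t - 1)) (2 * D) z p q
  have hmu1 := abs_sum_sub_sum_le_of_increment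
    (fun j t => (t : ℝ) * (d j - 1 - t) * (l - t)) (2 * D * l) z p q
  have hA : ∀ r, r = p ∨ r = q → |((z r + 1 : ℕ) : ℝ) * (((z r + 1 : ℕ) : ℝ) - 1)
      - (z r : ℝ) * (z r - 1)| ≤ 2 * D := fun r hr => by
    have h1 := hinc r hr
    have h2 := hdD r
    have h3 : (0 : ℝ) ≤ z r := by positivity
    push_cast
    rw [abs_le]
    constructor <;> nlinarith
  have hB : ∀ r, r = p ∨ r = q → |((z r + 1 : ℕ) : ℝ) * (d r - 1 - ((z r + 1 : ℕ) : ℝ))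
      * (l - ((z r + 1 : ℕ) : ℝ)) - (z r : ℝ) * (d r - 1 - z r) * (l - z r)| ≤ 2 * D * l :=
    fun r hr => by
      have h1 := hinc r hr
      have h2 := hdD r
      have h3 : (0 : ℝ) ≤ z r := by positivity
      have h4 := hzl r
      push_cast
      generalize (z r : ℝ) = t at *
      generalize (d r : ℝ) = b at *
      have e : (t + 1) * (b - 1 - (t + 1)) * (l - (t + 1)) - t * (b - 1 - t) * (l - t)
          = (l - t) * (b - 2 * t - 2) - (t + 1) * (b - t - 2) := by ring
      have h5 : |(l - t) * (b - 2 * t - 2)| ≤ l * D := by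
        rw [abs_mul]
        refine mul_le_mul ?_ ?_ (abs_nonneg _) hl.le
        · rw [abs_le]; constructor <;> linarith
        · rw [abs_le]; constructor <;> linarith
      have h6 : |(t + 1) * (b - t - 2)| ≤ l * D := by
        rw [abs_mul]
        calc |t + 1| * |b - t - 2| ≤ D * D := by
              refine mul_le_mul ?_ ?_ (abs_nonneg _) (by linarith)
              · rw [abs_le]; constructor <;> linarith
              · rw [abs_le]; constructor <;> linarith
          _ ≤ l * D := by nlinarith
      rw [e]
      refine (abs_sub _ _).trans ?_
      linarith
  have hlam := hlam1 (hA p (Or.inl rfl)) (hA q (Or.inr rfl))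
  have hmu := hmu1 (hB p (Or.inl rfl)) (hB q (Or.inr rfl))
  set yp : Fin n → ℕ := fun j => z j + if j = p then 1 else 0 with hyp
  set yq : Fin n → ℕ := fun j => z j + if j = q then 1 else 0 with hyq
  have hdlam : |lamResidual l yp - lamResidual l yq| ≤ 2 * D / l := by
    unfold lamResidual
    rw [← sub_div, abs_div, abs_of_pos (by positivity : (0 : ℝ) < 2 * l),
      div_le_div_iff₀ (by positivity) hl]
    have := mul_le_mul_of_nonneg_right hlam hl.le
    linarith
  have hdmu : |muResidual d l yp - muResidual d l yq| ≤ 12 * D ^ 2 / l := by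
    unfold muResidual
    have hpos : (0 : ℝ) < (n - 2) * l := mul_pos (by linarith) hl
    rw [← sub_div, abs_div, abs_of_pos hpos, div_le_div_iff₀ hpos hl]
    have h1 := mul_le_mul_of_nonneg_right hmu hl.le
    refine h1.trans ?_
    have h2 : 4 * D * l ≤ 12 * D ^ 2 * (n - 2) := by nlinarith
    nlinarith
  have hp0 := lamResidual_nonneg hl yp
  have hq0 := lamResidual_nonneg hl yq
  have hp1 := lamResidual_le hl yp (fun j => hyD p j (Or.inl rfl)) (hsumr p)
  have hq1 := lamResidual_le hl yq (fun j => hyD q j (Or.inr rfl)) (hsumr q)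
  generalize lamResidual l yp = a at *
  generalize lamResidual l yq = b at *
  generalize muResidual d l yp = a' at *
  generalize muResidual d l yq = b' at *
  have e : (K - a - a ^ 2 - a') - (K - b - b ^ 2 - b') = -((a - b) * (1 + (a + b)) + (a' - b')) := by
    ring
  rw [e, abs_neg]
  have h1 : |(a - b) * (1 + (a + b))| ≤ 2 * D / l * (2 * D) := by
    rw [abs_mul]
    refine mul_le_mul hdlam ?_ (abs_nonneg _) (by positivity)
    rw [abs_of_nonneg (by linarith)]
    linarith
  refine (abs_add_le _ _).trans ((add_le_add h1 hdmu).trans (le_of_eq ?_))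
  field_simp
  ring

theorem sum_card_inter {n M : ℕ} {A : Fin n → Finset (Fin M)}
    (hdisj : ∀ i j, i ≠ j → Disjoint (A i) (A j)) (hcov : ∀ v : Fin M, ∃ j, v ∈ A j)
    (U : Finset (Fin M)) : ∑ j, (A j ∩ U).card = U.card := by
  rw [← Finset.card_biUnion]
  · congr 1
    ext v
    simp only [Finset.mem_biUnion, Finset.mem_univ, true_and, Finset.mem_inter]
    exact ⟨fun ⟨_, h⟩ => h.2, fun h => (hcov v).imp fun _ hj => ⟨hj, h⟩⟩
  · exact fun i _ j _ hij =>
      (hdisj i j hij).mono Finset.inter_subset_left Finset.inter_subset_left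

theorem card_inter_insert {n M : ℕ} {A : Fin n → Finset (Fin M)}
    (hdisj : ∀ i j, i ≠ j → Disjoint (A i) (A j)) {U : Finset (Fin M)} {a : Fin M} {p : Fin n}
    (ha : a ∉ U) (hap : a ∈ A p) (j : Fin n) :
    (A j ∩ insert a U).card = (A j ∩ U).card + if j = p then 1 else 0 := by
  split_ifs with h
  · subst h
    rw [Finset.inter_insert_of_mem hap, Finset.card_insert_of_notMem (by simp [ha])]
  · rw [Finset.inter_insert_of_notMem fun haj => Finset.disjoint_left.1 (hdisj j p h) haj hap,
      add_zero]

theorem gfun_compl_eq {n M k : ℕ} {d : Fin n → ℕ} {A : Fin n → Finset (Fin M)} (hn : 3 ≤ n)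
    (hd : ∀ j, 1 ≤ d j) (hk0 : 0 < k) (hk : ∑ j, d j + 2 = 2 * n + k) (hMk : n - 2 + k = M)
    (hdisj : ∀ i j, i ≠ j → Disjoint (A i) (A j)) (hcov : ∀ v : Fin M, ∃ j, v ∈ A j)
    (hcard : ∀ j, (A j).card = d j - 1) {U : Finset (Fin M)} (hU : U.card = k) :
    gfun n d (fun j => (A j ∩ Uᶜ).card + 1)
      = ((Rvar n d + davg n d ^ 2) ^ 2 / (4 * davg n d ^ 2) - 1 / 4)
        - lamResidual k (fun j => (A j ∩ U).card)
        - lamResidual k (fun j => (A j ∩ U).card) ^ 2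
        - muResidual d k (fun j => (A j ∩ U).card) := by
  have hkR : ∑ j, (d j : ℝ) - 2 * n + 2 = k := by
    have : (∑ j, (d j : ℝ)) + 2 = 2 * n + k := by exact_mod_cast hk
    linarith
  have hsplit : ∀ j, (A j ∩ Uᶜ).card + (A j ∩ U).card = d j - 1 := fun j => by
    rw [← hcard j, ← Finset.sdiff_eq_inter_compl, Finset.card_sdiff_add_card_inter]
  have hres : (fun j => d j - ((A j ∩ Uᶜ).card + 1)) = fun j => (A j ∩ U).card := by
    funext j
    have := hsplit j
    have := hd j
    omega
  have hsum : ∑ j, ((A j ∩ Uᶜ).card + 1) + 2 = 2 * n := by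
    rw [Finset.sum_add_distrib, sum_card_inter hdisj hcov, Finset.card_compl, hU]
    simp
    omega
  unfold gfun
  rw [lamx_eq_lamResidual (by omega), mubar_eq_muResidual hn d _ (fun j => by omega)
    (fun j => by have := hsplit j; have := hd j; omega) hsum
    (by rw [hkR]; exact_mod_cast hk0), hres, hkR]

theorem swapLipschitz_gfun {n M k D : ℕ} {d : Fin n → ℕ} {A : Fin n → Finset (Fin M)}
    (hn : 3 ≤ n) (hd : ∀ j, 1 ≤ d j) (hdD : ∀ j, d j ≤ D) (hD1 : (1 : ℝ) ≤ D)
    (hDk : (D : ℝ) ^ 2 ≤ k) (hkn : (k : ℝ) ≤ D * n)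
    (hk : ∑ j, d j + 2 = 2 * n + k) (hMk : n - 2 + k = M)
    (hdisj : ∀ i j, i ≠ j → Disjoint (A i) (A j)) (hcov : ∀ v : Fin M, ∃ j, v ∈ A j)
    (hcard : ∀ j, (A j).card = d j - 1) :
    SwapLipschitz Finset.univ k (fun U => gfun n d (fun j => (A j ∩ Uᶜ).card + 1))
      (16 * (D : ℝ) ^ 2 / k) := by
  intro U a b ha hb _ hA hB
  rw [Finset.mem_powersetCard] at hA hB
  obtain ⟨p, hp⟩ := hcov a
  obtain ⟨q, hq⟩ := hcov b
  have hk0 : 0 < k := by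
    have : (0 : ℝ) < k := by nlinarith
    exact_mod_cast this
  have hUk : U.card + 1 = k := by rw [← hA.2, Finset.card_insert_of_notMem ha]
  have hle : ∀ (X : Finset (Fin M)) j, (A j ∩ X).card + 1 ≤ d j := fun X j => by
    have := Finset.card_le_card (Finset.inter_subset_left (s₁ := A j) (s₂ := X))
    have := hcard j
    have := hd j
    omega
  dsimp only
  rw [gfun_compl_eq hn hd hk0 hk hMk hdisj hcov hcard hA.2,
    gfun_compl_eq hn hd hk0 hk hMk hdisj hcov hcard hB.2]
  simp only [card_inter_insert hdisj ha hp, card_inter_insert hdisj hb hq]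
  refine abs_residual_sub_le hn d hD1 hDk hkn (fun j => by exact_mod_cast hdD j)
    (fun j => (A j ∩ U).card) p q ?_ (hle U) ?_ _
  · rintro r (rfl | rfl)
    · have := hle (insert a U) r
      rw [card_inter_insert hdisj ha hp, if_pos rfl] at this
      exact this
    · have := hle (insert b U) r
      rw [card_inter_insert hdisj hb hq, if_pos rfl] at this
      exact this
  · have := sum_card_inter hdisj hcov U
    rw [← hUk, ← this]
    push_cast
    rfl

theorem sum_powersetCard_compl {M k l : ℕ} (h : l + k = M) (F : Finset (Fin M) → ℝ) :
    ∑ U ∈ Finset.powersetCard k Finset.univ, F Uᶜ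
      = ∑ B ∈ Finset.powersetCard l Finset.univ, F B := by
  refine Finset.sum_nbij' (fun U => Uᶜ) (fun B => Bᶜ) ?_ ?_ ?_ ?_ ?_
  · intro U hU
    simp only [Finset.mem_powersetCard_univ, Finset.card_compl, Fintype.card_fin] at hU ⊢
    omega
  · intro U hU
    simp only [Finset.mem_powersetCard_univ, Finset.card_compl, Fintype.card_fin] at hU ⊢
    omega
  all_goals simp

theorem card_powersetCard_compl {M k l : ℕ} (h : l + k = M) :
    ((Finset.powersetCard k (Finset.univ : Finset (Fin M))).card : ℝ)
      = (Finset.powersetCard l (Finset.univ : Finset (Fin M))).card := by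
  simpa using sum_powersetCard_compl h (fun _ => 1)

theorem size_bounds {n D : ℕ} {d : Fin n → ℕ} (hn : 0 < n) (hd : ∀ j, 1 ≤ d j)
    (hdD : ∀ j, d j ≤ D) (hD : (D : ℝ) ^ 4 ≤ ∑ j, (d j : ℝ) - 2 * n) :
    ∑ j, (d j : ℝ) - 2 * n + 2 ≤ D * n ∧ 3 ≤ n ∧ 2 * n < ∑ j, d j := by
  have hn1 : (1 : ℝ) ≤ n := by exact_mod_cast hn
  have hD1 : (1 : ℝ) ≤ D := by exact_mod_cast (hd ⟨0, hn⟩).trans (hdD _)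
  have hsum : ∑ j, (d j : ℝ) ≤ D * n := by
    calc ∑ j, (d j : ℝ) ≤ ∑ _j : Fin n, (D : ℝ) :=
          Finset.sum_le_sum fun j _ => by exact_mod_cast hdD j
      _ = D * n := by simp; ring
  have h4 : (1 : ℝ) ≤ (D : ℝ) ^ 4 := one_le_pow₀ hD1
  refine ⟨by linarith, ?_, ?_⟩
  · have h2 : (2 : ℝ) < D := by
      by_contra! h
      nlinarith
    have h3 : (2 : ℝ) < n := by
      by_contra! h
      nlinarith [pow_pos (by linarith : (0 : ℝ) < D) 3, pow_le_pow_left₀ (by norm_num) h2.le 3]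
    exact_mod_cast h3
  · have : (2 * n : ℝ) < ∑ j, (d j : ℝ) := by linarith
    exact_mod_cast this

theorem mgf_of_g_of_random_suitable_sequence :
    ∃ C : ℝ, 0 < C ∧ ∀ n : ℕ, ∀ d : Fin n → ℕ,
      (∀ j, 1 ≤ d j) → Even (∑ j, d j) →
      ((Finset.univ.sup d : ℕ) : ℝ) ^ 4 ≤ (davg n d - 2) * n →
      ∀ M : ℕ, M = (∑ j, d j) - n →
      ∀ A : Fin n → Finset (Fin M),
      -- `A 1, …, A n` is a partition of `{1,…,(d−1)n}` with `|A j| = d j − 1`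
      (∀ i j, i ≠ j → Disjoint (A i) (A j)) →
      (∀ v : Fin M, ∃ j, v ∈ A j) →
      (∀ j, (A j).card = d j - 1) →
      ∃ E : ℝ,
        |E| ≤ C * ((Finset.univ.sup d : ℕ) : ℝ) ^ 4 / ((davg n d - 2) * n) ∧
        (∑ B ∈ Finset.powersetCard (n - 2) (Finset.univ : Finset (Fin M)),
            Real.exp (gfun n d (fun j => (A j ∩ B).card + 1))) /
          ((Finset.powersetCard (n - 2) (Finset.univ : Finset (Fin M))).card : ℝ)
        = Real.exp
            ((∑ B ∈ Finset.powersetCard (n - 2) (Finset.univ : Finset (Fin M)),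
                gfun n d (fun j => (A j ∩ B).card + 1)) /
              ((Finset.powersetCard (n - 2) (Finset.univ : Finset (Fin M))).card : ℝ)
              + E) := by
  refine ⟨128, by norm_num, fun n d hd _ hD M hM A hdisj hcov hcard => ?_⟩
  rcases Nat.eq_zero_or_pos n with rfl | hn
  · subst hM
    exact ⟨0, by simp [davg], by simp⟩
  set D : ℕ := Finset.univ.sup d with hDdef
  have hdD : ∀ j, d j ≤ D := fun j => Finset.le_sup (Finset.mem_univ j)
  rw [davg_sub_two_mul n hn] at hD ⊢
  obtain ⟨hnD, hn3, hlt⟩ := size_bounds hn hd hdD hD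
  have hDn : (1 : ℝ) ≤ D := by exact_mod_cast (hd ⟨0, hn⟩).trans (hdD _)
  obtain ⟨k, hk⟩ : ∃ k, ∑ j, d j + 2 = 2 * n + k := ⟨∑ j, d j + 2 - 2 * n, by omega⟩
  have hkR : (k : ℝ) = ∑ j, (d j : ℝ) - 2 * n + 2 := by
    have : (∑ j, (d j : ℝ)) + 2 = 2 * n + k := by exact_mod_cast hk
    linarith
  have hMk : n - 2 + k = M := by omega
  set L : ℝ := ∑ j, (d j : ℝ) - 2 * n with hL
  have hLpos : 0 < L := lt_of_lt_of_le (by positivity) hD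
  have hkpos : (0 : ℝ) < k := by rw [hkR]; linarith
  set f : Finset (Fin M) → ℝ := fun B => gfun n d (fun j => (A j ∩ B).card + 1) with hf
  set c : ℝ := 16 * (D : ℝ) ^ 2 / k with hc
  have hsw : SwapLipschitz Finset.univ k (fun U => f Uᶜ) c :=
    swapLipschitz_gfun hn3 hd hdD (by linarith) (by
      have : (D : ℝ) ^ 2 ≤ (D : ℝ) ^ 4 := pow_le_pow_right₀ hDn (by norm_num)
      linarith) (hkR.trans_le hnD) hk hMk hdisj hcov hcard
  have hmgf := hsw.sum_exp_le (by positivity)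
  rw [sum_powersetCard_compl hMk (fun B => Real.exp (f B)), sum_powersetCard_compl hMk f,
    card_powersetCard_compl hMk] at hmgf
  set P := Finset.powersetCard (n - 2) (Finset.univ : Finset (Fin M)) with hP
  have hPpos : (0 : ℝ) < P.card := by
    have : 0 < P.card := by
      rw [hP, Finset.card_powersetCard, Finset.card_univ, Fintype.card_fin]
      exact Nat.choose_pos (by omega)
    exact_mod_cast this
  have hjensen := card_mul_exp_mean_le P f
  set m := (∑ B ∈ P, f B) / (P.card : ℝ) with hm
  set Q := (∑ B ∈ P, Real.exp (f B)) / (P.card : ℝ) with hQ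
  have hlow : Real.exp m ≤ Q := by
    rw [hQ, le_div_iff₀ hPpos]; linarith
  have hup : Q ≤ Real.exp (m + k * (c ^ 2 / 2)) := by
    rw [hQ, div_le_iff₀ hPpos]; linarith
  have hQpos : 0 < Q := (Real.exp_pos m).trans_le hlow
  refine ⟨Real.log Q - m, ?_, ?_⟩
  · have h1 : m ≤ Real.log Q := (Real.le_log_iff_exp_le hQpos).2 hlow
    have h2 : Real.log Q ≤ m + k * (c ^ 2 / 2) := (Real.log_le_iff_le_exp hQpos).2 hup
    rw [abs_of_nonneg (by linarith)]
    have h3 : k * (c ^ 2 / 2) = 128 * (D : ℝ) ^ 4 / k := by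
      rw [hc]; field_simp; norm_num
    have h4 : 128 * (D : ℝ) ^ 4 / k ≤ 128 * (D : ℝ) ^ 4 / L := by
      apply div_le_div_of_nonneg_left (by positivity) hLpos
      rw [hkR]; linarith
    linarith
  · rw [add_sub_cancel, Real.exp_log hQpos]

end ExpectedSpanningTrees
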